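/- Let A be an ε-bialgebra over a commutative ring k and let M be an ε-Hopf bimodule over A, with actions a·m, m·a and coactions Λ(m) = m₋₁ ⊗ m₀, Ξ(m) = m₀ ⊗ m₁. Define a ∘ b := b₁·a·b₂ on A, a ∘ m := (m₋₁·a)·m₀ + m₀·(a·m₁), and m ∘ a := a₁·m·a₂ (left action of a₁ and right action of a₂). Then M is a pre-Lie bimodule over (A, ∘): for all a, b ∈ A and m ∈ M, a ∘ (b ∘ m) − (a ∘ b) ∘ m = b ∘ (a ∘ m) − (b ∘ a) ∘ m, and a ∘ (m ∘ b) − (a ∘ m) ∘ b = m ∘ (a ∘ b) − (m ∘ a) ∘ b. -/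

import Mathlib

open TensorProduct

/-- The map `A ⊗ A →ₗ A`, `x ⊗ y ↦ x * a * y`. -/
noncomputable def sandwich (k : Type*) {A : Type*} [CommRing k] [NonUnitalRing A]
    [Module k A] [SMulCommClass k A A] [IsScalarTower k A A] (a : A) :
    A ⊗[k] A →ₗ[k] A :=
  TensorProduct.lift (LinearMap.mk₂ k (fun x y => x * a * y)
    (fun x x' y => by simp [add_mul])
    (fun c x y => by simp [smul_mul_assoc])
    (fun x y y' => by simp [mul_add])
    (fun c x y => by simp [mul_smul_comm]))

/-- The map `A ⊗ M →ₗ M`, `x ⊗ m ↦ (x * a) · m`, for a left action `μL`. -/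
noncomputable def actSandwich (k : Type*) {A M : Type*} [CommRing k] [NonUnitalRing A]
    [Module k A] [SMulCommClass k A A] [IsScalarTower k A A]
    [AddCommGroup M] [Module k M]
    (μL : A →ₗ[k] M →ₗ[k] M) (a : A) : A ⊗[k] M →ₗ[k] M :=
  TensorProduct.lift (LinearMap.mk₂ k (fun x m => μL (x * a) m)
    (fun x x' m => by simp [add_mul])
    (fun c x m => by simp [smul_mul_assoc])
    (fun x m m' => by simp)
    (fun c x m => by simp))

/-- The map `M ⊗ A →ₗ M`, `m ⊗ y ↦ m · (a * y)`, for a right action `ν`. -/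
noncomputable def actSandwichR (k : Type*) {A M : Type*} [CommRing k] [NonUnitalRing A]
    [Module k A] [SMulCommClass k A A] [IsScalarTower k A A]
    [AddCommGroup M] [Module k M]
    (ν : M →ₗ[k] A →ₗ[k] M) (a : A) : M ⊗[k] A →ₗ[k] M :=
  TensorProduct.lift (LinearMap.mk₂ k (fun m y => ν m (a * y))
    (fun m m' y => by simp)
    (fun c m y => by simp)
    (fun m y y' => by simp [mul_add])
    (fun c m y => by simp [mul_smul_comm]))

/-- The map `A ⊗ A →ₗ M`, `x ⊗ y ↦ (x · m) · y`, for a bimodule `(μL, ν)`. -/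
noncomputable def biAct (k : Type*) {A M : Type*} [CommRing k] [NonUnitalRing A]
    [Module k A] [SMulCommClass k A A] [IsScalarTower k A A]
    [AddCommGroup M] [Module k M]
    (μL : A →ₗ[k] M →ₗ[k] M) (ν : M →ₗ[k] A →ₗ[k] M) (m : M) :
    A ⊗[k] A →ₗ[k] M :=
  TensorProduct.lift (LinearMap.mk₂ k (fun x y => ν (μL x m) y)
    (fun x x' y => by simp)
    (fun c x y => by simp)
    (fun x y y' => by simp)
    (fun c x y => by simp))

namespace EpsilonHopfBimodule

open TensorProduct (map assoc map_tmul add_tmul)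
open LinearMap (mulLeft mulRight)

variable {k A M : Type*} [CommRing k] [NonUnitalRing A] [Module k A] [SMulCommClass k A A]
  [IsScalarTower k A A] [AddCommGroup M] [Module k M]
  {μL : A →ₗ[k] M →ₗ[k] M} {ν : M →ₗ[k] A →ₗ[k] M}

/-! ### Values on pure tensors -/

@[simp]
theorem sandwich_tmul (a x y : A) : sandwich k a (x ⊗ₜ[k] y) = x * a * y := rfl

@[simp]
theorem actSandwich_tmul (a x : A) (m : M) :
    actSandwich k μL a (x ⊗ₜ[k] m) = μL (x * a) m := rfl

@[simp]
theorem actSandwichR_tmul (a y : A) (m : M) :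
    actSandwichR k ν a (m ⊗ₜ[k] y) = ν m (a * y) := rfl

@[simp]
theorem biAct_tmul (m : M) (x y : A) :
    biAct k μL ν m (x ⊗ₜ[k] y) = ν (μL x m) y := rfl

/-! ### Compatibility of the sandwich maps with the actions on either tensor factor -/

theorem sandwich_mulLeft (a c : A) (t : A ⊗[k] A) :
    sandwich k a (map (mulLeft k c) .id t) =
      c * sandwich k a t := by
  induction t with
  | zero => simp
  | tmul x y => simp [mul_assoc]
  | add s t hs ht => simp [mul_add, hs, ht]

theorem sandwich_mulRight (a c : A) (t : A ⊗[k] A) :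
    sandwich k a (map .id (mulRight k c) t) =
      sandwich k a t * c := by
  induction t with
  | zero => simp
  | tmul x y => simp [mul_assoc]
  | add s t hs ht => simp [add_mul, hs, ht]

theorem actSandwich_mulLeft
    (hμL : ∀ (a b : A) (m : M), μL (a * b) m = μL a (μL b m))
    (a c : A) (t : A ⊗[k] M) :
    actSandwich k μL a (map (mulLeft k c) .id t) =
      μL c (actSandwich k μL a t) := by
  induction t with
  | zero => simp
  | tmul x y => simp [hμL, mul_assoc]
  | add s t hs ht => simp [hs, ht]

theorem actSandwich_flip_left
    (hμL : ∀ (a b : A) (m : M), μL (a * b) m = μL a (μL b m))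
    (a : A) (n : M) (t : A ⊗[k] A) :
    actSandwich k μL a (map .id (μL.flip n) t) =
      μL (sandwich k a t) n := by
  induction t with
  | zero => simp
  | tmul x y => simp [hμL]
  | add s t hs ht => simp [hs, ht]

theorem actSandwich_flip_right
    (hbimod : ∀ (a : A) (m : M) (b : A), ν (μL a m) b = μL a (ν m b))
    (a c : A) (t : A ⊗[k] M) :
    actSandwich k μL a (map .id (ν.flip c) t) =
      ν (actSandwich k μL a t) c := by
  induction t with
  | zero => simp
  | tmul x y => simp [hbimod]
  | add s t hs ht => simp [hs, ht]

theorem actSandwichR_map_left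
    (hbimod : ∀ (a : A) (m : M) (b : A), ν (μL a m) b = μL a (ν m b))
    (a c : A) (t : M ⊗[k] A) :
    actSandwichR k ν a (map (μL c) .id t) =
      μL c (actSandwichR k ν a t) := by
  induction t with
  | zero => simp
  | tmul x y => simp [hbimod]
  | add s t hs ht => simp [hs, ht]

theorem actSandwichR_mulRight
    (hν : ∀ (m : M) (a b : A), ν (ν m a) b = ν m (a * b))
    (a c : A) (t : M ⊗[k] A) :
    actSandwichR k ν a (map .id (mulRight k c) t) =
      ν (actSandwichR k ν a t) c := by
  induction t with
  | zero => simp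
  | tmul x y => simp [hν, mul_assoc]
  | add s t hs ht => simp [hs, ht]

theorem actSandwichR_map_right
    (hν : ∀ (m : M) (a b : A), ν (ν m a) b = ν m (a * b))
    (a : A) (m : M) (t : A ⊗[k] A) :
    actSandwichR k ν a (map (ν m) .id t) =
      ν m (sandwich k a t) := by
  induction t with
  | zero => simp
  | tmul x y => simp [hν, mul_assoc]
  | add s t hs ht => simp [hs, ht]

theorem biAct_mulLeft
    (hμL : ∀ (a b : A) (m : M), μL (a * b) m = μL a (μL b m))
    (hbimod : ∀ (a : A) (m : M) (b : A), ν (μL a m) b = μL a (ν m b))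
    (c : A) (m : M) (t : A ⊗[k] A) :
    biAct k μL ν m (map (mulLeft k c) .id t) =
      μL c (biAct k μL ν m t) := by
  induction t with
  | zero => simp
  | tmul x y => simp [hμL, hbimod]
  | add s t hs ht => simp [hs, ht]

theorem biAct_mulRight
    (hν : ∀ (m : M) (a b : A), ν (ν m a) b = ν m (a * b))
    (c : A) (m : M) (t : A ⊗[k] A) :
    biAct k μL ν m (map .id (mulRight k c) t) =
      ν (biAct k μL ν m t) c := by
  induction t with
  | zero => simp
  | tmul x y => simp [hν]
  | add s t hs ht => simp [hs, ht]

/-! ### Iterated sandwich maps on reassociated tensors -/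

theorem actSandwich_actSandwich_assoc
    (hμL : ∀ (a b : A) (m : M), μL (a * b) m = μL a (μL b m))
    (a b : A) (n : M) (t : A ⊗[k] A) :
    actSandwich k μL a (map .id (actSandwich k μL b) (assoc k A A M (t ⊗ₜ[k] n))) =
      μL (sandwich k a t * b) n := by
  induction t with
  | zero => simp
  | tmul x y => simp [hμL, mul_assoc]
  | add s t hs ht => simp [add_mul, add_tmul, hs, ht]

theorem actSandwich_actSandwichR_assoc
    (hbimod : ∀ (a : A) (m : M) (b : A), ν (μL a m) b = μL a (ν m b))
    (a b y : A) (t : A ⊗[k] M) :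
    actSandwich k μL a (map .id (actSandwichR k ν b) (assoc k A M A (t ⊗ₜ[k] y))) =
      ν (actSandwich k μL a t) (b * y) := by
  induction t with
  | zero => simp
  | tmul x n => simp [hbimod]
  | add s t hs ht => simp [add_tmul, hs, ht]

theorem actSandwichR_sandwich_assoc
    (hν : ∀ (m : M) (a b : A), ν (ν m a) b = ν m (a * b))
    (a b y : A) (t : M ⊗[k] A) :
    actSandwichR k ν a (map .id (sandwich k b) (assoc k M A A (t ⊗ₜ[k] y))) =
      ν (actSandwichR k ν a t) (b * y) := by
  induction t with
  | zero => simp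
  | tmul n x => simp [hν, mul_assoc]
  | add s t hs ht => simp [add_tmul, hs, ht]

theorem actSandwich_biAct_assoc
    (hμL : ∀ (a b : A) (m : M), μL (a * b) m = μL a (μL b m))
    (hbimod : ∀ (a : A) (m : M) (b : A), ν (μL a m) b = μL a (ν m b))
    (a y : A) (m : M) (t : A ⊗[k] A) :
    actSandwich k μL a (map .id (biAct k μL ν m) (assoc k A A A (t ⊗ₜ[k] y))) =
      ν (μL (sandwich k a t) m) y := by
  induction t with
  | zero => simp
  | tmul x z => simp [hμL, hbimod]
  | add s t hs ht => simp [add_tmul, hs, ht]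

theorem biAct_sandwich_assoc
    (hν : ∀ (m : M) (a b : A), ν (ν m a) b = ν m (a * b))
    (a y : A) (m : M) (t : A ⊗[k] A) :
    biAct k μL ν m (map .id (sandwich k a) (assoc k A A A (t ⊗ₜ[k] y))) =
      ν (biAct k μL ν m t) (a * y) := by
  induction t with
  | zero => simp
  | tmul x z => simp [hν, mul_assoc]
  | add s t hs ht => simp [add_tmul, hs, ht]

/-! ### The sandwich operations applied to one another -/

/-- The multiplicative and mixed axioms of an ε-Hopf bimodule; the coassociativity conditions are
left out. -/
structure IsCompatible (Δ : A →ₗ[k] A ⊗[k] A) (μL : A →ₗ[k] M →ₗ[k] M) (ν : M →ₗ[k] A →ₗ[k] M)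
    (Λ : M →ₗ[k] A ⊗[k] M) (Ξ : M →ₗ[k] M ⊗[k] A) : Prop where
  comul_mul (a b : A) : Δ (a * b) = map (mulLeft k a) .id (Δ b) + map .id (mulRight k b) (Δ a)
  mul_left (a b : A) (m : M) : μL (a * b) m = μL a (μL b m)
  mul_right (m : M) (a b : A) : ν (ν m a) b = ν m (a * b)
  left_right (a : A) (m : M) (b : A) : ν (μL a m) b = μL a (ν m b)
  leftCoact_left (a : A) (m : M) :
    Λ (μL a m) = map (mulLeft k a) .id (Λ m) + map .id (μL.flip m) (Δ a)
  leftCoact_right (m : M) (a : A) : Λ (ν m a) = map .id (ν.flip a) (Λ m)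
  rightCoact_left (a : A) (m : M) : Ξ (μL a m) = map (μL a) .id (Ξ m)
  rightCoact_right (m : M) (a : A) :
    Ξ (ν m a) = map .id (mulRight k a) (Ξ m) + map (ν m) .id (Δ a)

variable {Δ : A →ₗ[k] A ⊗[k] A} {Λ : M →ₗ[k] A ⊗[k] M} {Ξ : M →ₗ[k] M ⊗[k] A}

/-- `a ∘ ((x * b) · n)`, expanded for `x ⊗ n` extended linearly to `t`. -/
theorem IsCompatible.circL_actSandwich (h : IsCompatible Δ μL ν Λ Ξ)
    (a b : A) (t : A ⊗[k] M) :
    actSandwich k μL a (Λ (actSandwich k μL b t)) + actSandwichR k ν a (Ξ (actSandwich k μL b t)) =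
      actSandwich k μL b (map .id (actSandwich k μL a) (map .id Λ t))
      + actSandwich k μL a (map .id (actSandwich k μL b) (assoc k A A M (map Δ .id t)))
      + actSandwich k μL b (map .id (actSandwichR k ν a) (map .id Ξ t))
      + actSandwich k μL (sandwich k a (Δ b)) t := by
  induction t with
  | zero => simp
  | tmul x y =>
    simp only [map_tmul, LinearMap.id_coe, id_eq, actSandwich_tmul, h.leftCoact_left,
      h.rightCoact_left, h.comul_mul, map_add, actSandwich_mulLeft h.mul_left,
      actSandwich_flip_left h.mul_left, sandwich_mulLeft, sandwich_mulRight, actSandwichR_map_left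
      h.left_right, actSandwich_actSandwich_assoc h.mul_left]
    abel
  | add s t hs ht =>
    simp only [map_add] at hs ht ⊢
    rw [add_add_add_comm, hs, ht]
    abel

/-- `a ∘ (p · (b * y))`, expanded for `p ⊗ y` extended linearly to `t`. -/
theorem IsCompatible.circL_actSandwichR (h : IsCompatible Δ μL ν Λ Ξ)
    (a b : A) (t : M ⊗[k] A) :
    actSandwich k μL a (Λ (actSandwichR k ν b t)) + actSandwichR k ν a (Ξ (actSandwichR k ν b t)) =
      actSandwich k μL a (map .id (actSandwichR k ν b) (assoc k A M A (map Λ .id t)))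
      + actSandwichR k ν a (map .id (sandwich k b) (assoc k M A A (map Ξ .id t)))
      + actSandwichR k ν b (map .id (sandwich k a) (map .id Δ t))
      + actSandwichR k ν (sandwich k a (Δ b)) t := by
  induction t with
  | zero => simp
  | tmul x y =>
    simp only [map_tmul, LinearMap.id_coe, id_eq, actSandwichR_tmul, h.leftCoact_right,
      h.rightCoact_right, h.comul_mul, map_add, actSandwich_flip_right h.left_right,
      actSandwichR_mulRight h.mul_right, actSandwichR_map_right h.mul_right, sandwich_mulLeft,
      sandwich_mulRight, actSandwich_actSandwichR_assoc h.left_right, actSandwichR_sandwich_assoc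
      h.mul_right]
    abel
  | add s t hs ht =>
    simp only [map_add] at hs ht ⊢
    rw [add_add_add_comm, hs, ht]
    abel

/-- `a ∘ (x · m · y)`, expanded for `x ⊗ y` extended linearly to `t`. -/
theorem IsCompatible.circL_biAct (h : IsCompatible Δ μL ν Λ Ξ)
    (a : A) (m : M) (t : A ⊗[k] A) :
    actSandwich k μL a (Λ (biAct k μL ν m t)) + actSandwichR k ν a (Ξ (biAct k μL ν m t)) =
      actSandwich k μL a (map .id (biAct k μL ν m) (assoc k A A A (map Δ .id t)))
      + biAct k μL ν m (map .id (sandwich k a) (map .id Δ t))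
      + biAct k μL ν (actSandwich k μL a (Λ m) + actSandwichR k ν a (Ξ m)) t := by
  induction t with
  | zero => simp
  | tmul x y =>
    simp only [map_tmul, LinearMap.id_coe, id_eq, biAct_tmul, h.leftCoact_right,
      h.rightCoact_right, h.leftCoact_left, h.rightCoact_left, map_add, LinearMap.add_apply,
      actSandwich_mulLeft h.mul_left, actSandwich_flip_left h.mul_left, actSandwich_flip_right
      h.left_right, actSandwichR_map_left h.left_right, actSandwichR_mulRight h.mul_right,
      actSandwichR_map_right h.mul_right, actSandwich_biAct_assoc h.mul_left h.left_right]
    abel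
  | add s t hs ht =>
    simp only [map_add] at hs ht ⊢
    rw [add_add_add_comm, hs, ht]
    abel

/-- `m ∘ (x * a * y)`, expanded for `x ⊗ y` extended linearly to `t`. -/
theorem IsCompatible.biAct_comul_sandwich (h : IsCompatible Δ μL ν Λ Ξ)
    (a : A) (m : M) (t : A ⊗[k] A) :
    biAct k μL ν m (Δ (sandwich k a t)) =
      actSandwich k μL a (map .id (biAct k μL ν m) (map .id Δ t))
      + biAct k μL ν m (map .id (sandwich k a) (assoc k A A A (map Δ .id t)))
      + biAct k μL ν (biAct k μL ν m (Δ a)) t := by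
  induction t with
  | zero => simp
  | tmul x y =>
    simp only [map_tmul, LinearMap.id_coe, id_eq, sandwich_tmul, actSandwich_tmul, biAct_tmul,
      h.comul_mul, map_add, biAct_mulLeft h.mul_left h.left_right, biAct_mulRight h.mul_right,
      biAct_sandwich_assoc h.mul_right, h.mul_right]
    abel
  | add s t hs ht =>
    simp only [map_add] at hs ht ⊢
    rw [hs, ht]
    abel

end EpsilonHopfBimodule

/-- An ε-Hopf bimodule `M` over an ε-bialgebra `A` is a pre-Lie bimodule over the
associated pre-Lie algebra `(A, ∘)`, via `a ∘ m = (m₋₁·a)·m₀ + m₀·(a·m₁)` and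
`m ∘ a = a₁·m·a₂`. -/
theorem epsilonHopfBimodule_preLieBimodule {k A M : Type*} [CommRing k]
    [NonUnitalRing A] [Module k A] [SMulCommClass k A A] [IsScalarTower k A A]
    [AddCommGroup M] [Module k M]
    (Δ : A →ₗ[k] A ⊗[k] A)
    (hcoassoc : ∀ a : A,
      (TensorProduct.assoc k A A A) ((TensorProduct.map Δ LinearMap.id) (Δ a)) =
        (TensorProduct.map LinearMap.id Δ) (Δ a))
    (hder : ∀ a b : A,
      Δ (a * b) = (TensorProduct.map (LinearMap.mulLeft k a) LinearMap.id) (Δ b)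
        + (TensorProduct.map LinearMap.id (LinearMap.mulRight k b)) (Δ a))
    (μL : A →ₗ[k] M →ₗ[k] M)
    (hμL : ∀ (a b : A) (m : M), μL (a * b) m = μL a (μL b m))
    (ν : M →ₗ[k] A →ₗ[k] M)
    (hν : ∀ (m : M) (a b : A), ν (ν m a) b = ν m (a * b))
    (hbimod : ∀ (a : A) (m : M) (b : A), ν (μL a m) b = μL a (ν m b))
    (Λ : M →ₗ[k] A ⊗[k] M)
    (hΛcoassoc : ∀ m : M,
      (TensorProduct.assoc k A A M) ((TensorProduct.map Δ LinearMap.id) (Λ m)) =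
        (TensorProduct.map LinearMap.id Λ) (Λ m))
    (hΛcompat : ∀ (a : A) (m : M),
      Λ (μL a m) = (TensorProduct.map (LinearMap.mulLeft k a) LinearMap.id) (Λ m)
        + (TensorProduct.map LinearMap.id (μL.flip m)) (Δ a))
    (Ξ : M →ₗ[k] M ⊗[k] A)
    (hΞcoassoc : ∀ m : M,
      (TensorProduct.assoc k M A A) ((TensorProduct.map Ξ LinearMap.id) (Ξ m)) =
        (TensorProduct.map LinearMap.id Δ) (Ξ m))
    (hΞcompat : ∀ (m : M) (a : A),
      Ξ (ν m a) = (TensorProduct.map LinearMap.id (LinearMap.mulRight k a)) (Ξ m)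
        + (TensorProduct.map (ν m) LinearMap.id) (Δ a))
    (hbicomod : ∀ m : M,
      (TensorProduct.map LinearMap.id Ξ) (Λ m) =
        (TensorProduct.assoc k A M A) ((TensorProduct.map Λ LinearMap.id) (Ξ m)))
    (hΞleft : ∀ (a : A) (m : M),
      Ξ (μL a m) = (TensorProduct.map (μL a) LinearMap.id) (Ξ m))
    (hΛright : ∀ (m : M) (a : A),
      Λ (ν m a) = (TensorProduct.map LinearMap.id (ν.flip a)) (Λ m))
    (circ : A → A → A) (hcirc : ∀ a b : A, circ a b = sandwich k a (Δ b))
    (circL : A → M → M)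
    (hcircL : ∀ (a : A) (m : M),
      circL a m = actSandwich k μL a (Λ m) + actSandwichR k ν a (Ξ m))
    (circR : M → A → M)
    (hcircR : ∀ (m : M) (a : A), circR m a = biAct k μL ν m (Δ a)) :
    (∀ (a b : A) (m : M),
      circL a (circL b m) - circL (circ a b) m
        = circL b (circL a m) - circL (circ b a) m)
    ∧ (∀ (a b : A) (m : M),
      circL a (circR m b) - circR (circL a m) b
        = circR m (circ a b) - circR (circR m a) b) := by
  have h : EpsilonHopfBimodule.IsCompatible Δ μL ν Λ Ξ :=
    ⟨hder, hμL, hν, hbimod, hΛcompat, hΛright, hΞleft, hΞcompat⟩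
  have key : ∀ (a b : A) (m : M), circL a (circL b m) - circL (circ a b) m =
      actSandwich k μL b (TensorProduct.map .id (actSandwich k μL a)
          (TensorProduct.map .id Λ (Λ m)))
        + actSandwich k μL a (TensorProduct.map .id (actSandwich k μL b)
          (TensorProduct.map .id Λ (Λ m)))
        + actSandwich k μL b (TensorProduct.map .id (actSandwichR k ν a)
          (TensorProduct.map .id Ξ (Λ m)))
        + actSandwich k μL a (TensorProduct.map .id (actSandwichR k ν b)
          (TensorProduct.map .id Ξ (Λ m)))
        + actSandwichR k ν a (TensorProduct.map .id (sandwich k b)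
          (TensorProduct.map .id Δ (Ξ m)))
        + actSandwichR k ν b (TensorProduct.map .id (sandwich k a)
          (TensorProduct.map .id Δ (Ξ m))) := by
    intro a b m
    have hL := h.circL_actSandwich a b (Λ m)
    have hR := h.circL_actSandwichR a b (Ξ m)
    rw [hΛcoassoc] at hL
    rw [← hbicomod, hΞcoassoc] at hR
    simp only [hcircL, hcirc, map_add]
    rw [add_add_add_comm, hL, hR]
    abel
  refine ⟨fun a b m => ?_, fun a b m => ?_⟩
  · rw [key, key]
    abel
  · have hL := h.circL_biAct a m (Δ b)
    have hR := h.biAct_comul_sandwich a m (Δ b)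
    rw [hcoassoc] at hL hR
    simp only [hcircL, hcircR, hcirc]
    rw [hL, hR]
    abel
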